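/- Let x ∈ [0,1]^n satisfy max_{i,j} |x_i − x_j| ≤ ε, and let ξ_1,…,ξ_n ∈ ℝ satisfy |ξ_i| ≤ ε/2 for every i. Define the updated state x'_i = Π(|N(i,x)|^{-1} ∑_{j∈N(i,x)} x_j + ξ_i) for each i, where Π(y) = min(max(y,0),1). Then max_{i,j} |x'_i − x'_j| ≤ ε. -/

import Mathlib

open MeasureTheory ProbabilityTheory Filter

noncomputable def clip (y : ℝ) : ℝ := min (max y 0) 1

noncomputable def nbr {n : ℕ} (ε : ℝ) (x : Fin n → ℝ) (i : Fin n) : Finset (Fin n) :=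
  Finset.univ.filter (fun j => |x j - x i| ≤ ε)

noncomputable def locAvg {n : ℕ} (ε : ℝ) (x : Fin n → ℝ) (i : Fin n) : ℝ :=
  (∑ j ∈ nbr ε x i, x j) / ((nbr ε x i).card : ℝ)

noncomputable def hkStep {n : ℕ} (ε : ℝ) (x ξ : Fin n → ℝ) (i : Fin n) : ℝ :=
  clip (locAvg ε x i + ξ i)

noncomputable def dV {n : ℕ} (x : Fin n → ℝ) : ℝ := ⨆ i, ⨆ j, |x i - x j|

noncomputable def hkX {Ω : Type*} {n : ℕ} (ε : ℝ) (x0 : Fin n → ℝ)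
    (ξ : Fin n → ℕ → Ω → ℝ) (ω : Ω) : ℕ → Fin n → ℝ
  | 0 => x0
  | t + 1 => hkStep ε (hkX ε x0 ξ ω t) (fun i => ξ i (t + 1) ω)

theorem abs_clip_sub_clip_le (a b : ℝ) : |clip a - clip b| ≤ |a - b| := by
  unfold clip
  calc |min (max a 0) 1 - min (max b 0) 1| ≤ |max a 0 - max b 0| := by
        simpa using abs_min_sub_min_le_max (max a 0) 1 (max b 0) 1
    _ ≤ |a - b| := by simpa using abs_max_sub_max_le_max a 0 b 0

theorem nbr_eq_univ {n : ℕ} {ε : ℝ} {x : Fin n → ℝ}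
    (h : ∀ i j : Fin n, |x i - x j| ≤ ε) (i : Fin n) : nbr ε x i = Finset.univ :=
  Finset.filter_true_of_mem fun j _ => h j i

theorem locAvg_eq_of_abs_sub_le {n : ℕ} {ε : ℝ} {x : Fin n → ℝ}
    (h : ∀ i j : Fin n, |x i - x j| ≤ ε) (i j : Fin n) : locAvg ε x i = locAvg ε x j := by
  simp only [locAvg, nbr_eq_univ h]

/-- One-step absorption: if all pairwise distances are at most ε and every
noise is bounded by ε/2 in absolute value, then after one noisy HK update all
pairwise distances are still at most ε. -/
theorem hkStep_dV_le_of_dV_le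
    {n : ℕ} (hn : 1 ≤ n) (ε : ℝ) (hε : ε ∈ Set.Ioc (0 : ℝ) 1)
    (x : Fin n → ℝ) (hx : ∀ i, x i ∈ Set.Icc (0 : ℝ) 1)
    (h : ∀ i j : Fin n, |x i - x j| ≤ ε)
    (ξ : Fin n → ℝ) (hξ : ∀ i, |ξ i| ≤ ε / 2) :
    ∀ i j : Fin n, |hkStep ε x ξ i - hkStep ε x ξ j| ≤ ε := by
  intro i j
  calc |hkStep ε x ξ i - hkStep ε x ξ j|
      ≤ |(locAvg ε x i + ξ i) - (locAvg ε x j + ξ j)| := abs_clip_sub_clip_le _ _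
    _ = |ξ i - ξ j| := by rw [locAvg_eq_of_abs_sub_le h i j, add_sub_add_left_eq_sub]
    _ ≤ |ξ i| + |ξ j| := abs_sub _ _
    _ ≤ ε := by linarith [hξ i, hξ j]
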